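/- The category MF(k) of Fontaine–Laffaille modules over a perfect field k of characteristic p > 0 is an abelian category, and every morphism in MF(k) is strict with respect to the filtrations: if f : (V₁, Fil₁, ψ₁) → (V₂, Fil₂, ψ₂) is a morphism then f(Fil₁^i V₁) = f(V₁) ∩ Fil₂^i V₂ for all i. -/

import Mathlib

/-!
# The category `MF(k)` of Fontaine–Laffaille modules is abelian, with strict
morphisms

Let `k` be a perfect field of characteristic `p > 0` with Frobenius `F_k`.  A
Fontaine–Laffaille module over `k` is a triple `(V, Fil, ψ)` where `V` is a
finite-dimensional `k`-vector space, `Fil` a finite decreasing filtration on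
`V`, and `ψ : F_k^* Gr_Fil V ≅ V` a `k`-linear isomorphism, where
`F_k^* W = W ⊗_{k, F_k} k` is the Frobenius twist (the same additive group with
the `k`-action twisted through the Frobenius).  A morphism
`(V₁, Fil₁, ψ₁) → (V₂, Fil₂, ψ₂)` is a filtration-preserving `k`-linear map `f`
with `ψ₂ ∘ F_k^* Gr(f) = f ∘ ψ₁`.

The theorem: the category `MF(k)` of Fontaine–Laffaille modules is abelian, and
every morphism in `MF(k)` is strict with respect to the filtrations:
`f(Fil₁^i V₁) = f(V₁) ∩ Fil₂^i V₂` for all `i`.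
-/

open CategoryTheory DirectSum

universe u

variable (p : ℕ) [Fact p.Prime] (k : Type) [Field k] [CharP k p] [PerfectField k]

instance : ExpChar k p := ExpChar.prime Fact.out

/-- The Frobenius twist `F_k^* M = M ⊗_{k, σ} k` of a `k`-module `M` along a
ring endomorphism `σ` of `k`: the same additive group with the `k`-action
twisted by `σ`. -/
def Tw (σ : k →+* k) (M : Type u) [AddCommGroup M] [Module k M] : Type u := M

instance {σ : k →+* k} {M : Type u} [AddCommGroup M] [Module k M] :
    AddCommGroup (Tw k σ M) := ‹AddCommGroup M›

instance {σ : k →+* k} {M : Type u} [AddCommGroup M] [Module k M] :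
    Module k (Tw k σ M) := Module.compHom M σ

/-- The twist of a `k`-linear map. -/
def twMap {σ : k →+* k} {M N : Type u} [AddCommGroup M] [Module k M]
    [AddCommGroup N] [Module k N] (g : M →ₗ[k] N) :
    Tw k σ M →ₗ[k] Tw k σ N where
  toFun := g
  map_add' := g.map_add
  map_smul' a x := g.map_smul (σ a) x

variable {k}

/-- The `i`-th graded piece `Fil^i/Fil^{i+1}` of a filtered vector space. -/
def GrPiece {V : Type u} [AddCommGroup V] [Module k V]
    (Fil : ℤ → Submodule k V) (i : ℤ) : Type u :=
  ↥(Fil i) ⧸ (Submodule.comap (Fil i).subtype (Fil (i + 1)))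

instance {V : Type u} [AddCommGroup V] [Module k V] (Fil : ℤ → Submodule k V)
    (i : ℤ) : AddCommGroup (GrPiece Fil i) := by
  unfold GrPiece; infer_instance

instance {V : Type u} [AddCommGroup V] [Module k V] (Fil : ℤ → Submodule k V)
    (i : ℤ) : Module k (GrPiece Fil i) := by
  unfold GrPiece; infer_instance

/-- The total graded vector space `Gr_Fil V = ⨁_i Fil^i/Fil^{i+1}`. -/
def GrModule {V : Type u} [AddCommGroup V] [Module k V]
    (Fil : ℤ → Submodule k V) : Type u :=
  Π₀ i : ℤ, GrPiece Fil i

instance {V : Type u} [AddCommGroup V] [Module k V] (Fil : ℤ → Submodule k V) :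
    AddCommGroup (GrModule Fil) := by
  unfold GrModule; infer_instance

instance {V : Type u} [AddCommGroup V] [Module k V] (Fil : ℤ → Submodule k V) :
    Module k (GrModule Fil) := by
  unfold GrModule; infer_instance

variable (k) in
/-- A Fontaine–Laffaille module over the perfect field `k` of characteristic
`p`: a finite-dimensional `k`-vector space `V` with a finite decreasing
filtration `Fil` and a `k`-linear isomorphism `ψ : F_k^* Gr_Fil V ≅ V`. -/
structure FLMod where
  V : Type u
  [ag : AddCommGroup V]
  [mod : Module k V]
  findim : FiniteDimensional k V
  Fil : ℤ → Submodule k V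
  antitone : ∀ i j : ℤ, i ≤ j → Fil j ≤ Fil i
  exhaustive : ∃ a : ℤ, Fil a = ⊤
  separated : ∃ b : ℤ, Fil b = ⊥
  ψ : Tw k (frobenius k p) (GrModule Fil) ≃ₗ[k] V

attribute [instance] FLMod.ag FLMod.mod

variable {p}

section GrMapDefs

variable {V₁ V₂ V₃ : Type u} [AddCommGroup V₁] [Module k V₁] [AddCommGroup V₂]
  [Module k V₂] [AddCommGroup V₃] [Module k V₃]
  {Fil₁ : ℤ → Submodule k V₁} {Fil₂ : ℤ → Submodule k V₂}
  {Fil₃ : ℤ → Submodule k V₃}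

/-- The graded piece of the map `Gr(f)` induced by a filtration-preserving
linear map. -/
def grPieceMap (f : V₁ →ₗ[k] V₂) (hf : ∀ i, (Fil₁ i).map f ≤ Fil₂ i) (i : ℤ) :
    GrPiece Fil₁ i →ₗ[k] GrPiece Fil₂ i :=
  Submodule.mapQ (Submodule.comap (Fil₁ i).subtype (Fil₁ (i + 1)))
    (Submodule.comap (Fil₂ i).subtype (Fil₂ (i + 1)))
    (f.restrict (p := Fil₁ i) (q := Fil₂ i) (fun x hx => hf i ⟨x, hx, rfl⟩))
    (fun x hx => hf (i + 1) ⟨(x : V₁), hx, rfl⟩)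

/-- The graded map `Gr(f) : Gr_{Fil₁} V₁ → Gr_{Fil₂} V₂` induced by a
filtration-preserving linear map. -/
def grMap (f : V₁ →ₗ[k] V₂) (hf : ∀ i, (Fil₁ i).map f ≤ Fil₂ i) :
    GrModule Fil₁ →ₗ[k] GrModule Fil₂ :=
  DFinsupp.mapRange.linearMap (grPieceMap f hf)

theorem grPieceMap_id (hf : ∀ i, (Fil₁ i).map LinearMap.id ≤ Fil₁ i) (i : ℤ) :
    grPieceMap LinearMap.id hf i = LinearMap.id := by
  apply LinearMap.ext; intro x
  obtain ⟨y, rfl⟩ := Submodule.Quotient.mk_surjective _ x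
  show Submodule.mapQ _ _ _ _ _ = _
  rw [Submodule.mapQ_apply]
  rfl

theorem grMap_id (hf : ∀ i, (Fil₁ i).map LinearMap.id ≤ Fil₁ i) :
    grMap LinearMap.id hf = LinearMap.id := by
  unfold grMap
  rw [show grPieceMap LinearMap.id hf = fun i => (LinearMap.id (M := GrPiece Fil₁ i)) from
    funext (grPieceMap_id hf)]
  exact DFinsupp.mapRange.linearMap_id

theorem grPieceMap_comp (f : V₁ →ₗ[k] V₂) (hf : ∀ i, (Fil₁ i).map f ≤ Fil₂ i)
    (g : V₂ →ₗ[k] V₃) (hg : ∀ i, (Fil₂ i).map g ≤ Fil₃ i)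
    (hgf : ∀ i, (Fil₁ i).map (g ∘ₗ f) ≤ Fil₃ i) (i : ℤ) :
    grPieceMap (g ∘ₗ f) hgf i = (grPieceMap g hg i) ∘ₗ (grPieceMap f hf i) := by
  apply LinearMap.ext; intro x
  obtain ⟨y, rfl⟩ := Submodule.Quotient.mk_surjective _ x
  simp only [grPieceMap, LinearMap.comp_apply, Submodule.mapQ_apply]
  rfl

theorem grMap_comp (f : V₁ →ₗ[k] V₂) (hf : ∀ i, (Fil₁ i).map f ≤ Fil₂ i)
    (g : V₂ →ₗ[k] V₃) (hg : ∀ i, (Fil₂ i).map g ≤ Fil₃ i)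
    (hgf : ∀ i, (Fil₁ i).map (g ∘ₗ f) ≤ Fil₃ i) :
    grMap (g ∘ₗ f) hgf = (grMap g hg) ∘ₗ (grMap f hf) := by
  unfold grMap
  rw [show grPieceMap (g ∘ₗ f) hgf
      = fun i => (grPieceMap g hg i) ∘ₗ (grPieceMap f hf i) from
    funext (grPieceMap_comp f hf g hg hgf)]
  exact DFinsupp.mapRange.linearMap_comp _ _

end GrMapDefs

variable (p k)

/-- A morphism of Fontaine–Laffaille modules: a filtration-preserving `k`-linear
map `f` compatible with the `ψ`'s through `F_k^* Gr(f)`. -/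
@[ext]
structure FLHom (M N : FLMod p k) where
  f : M.V →ₗ[k] N.V
  hFil : ∀ i : ℤ, (M.Fil i).map f ≤ N.Fil i
  compat : N.ψ.toLinearMap ∘ₗ twMap k (grMap f hFil) = f ∘ₗ M.ψ.toLinearMap

/-- The category `MF(k)` of Fontaine–Laffaille modules over `k`. -/
instance : Category (FLMod p k) where
  Hom M N := FLHom p k M N
  id M := { f := LinearMap.id
            hFil := fun i => by rintro x ⟨y, hy, rfl⟩; exact hy
            compat := by
              have : grMap (Fil₁ := M.Fil) (Fil₂ := M.Fil) LinearMap.id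
                  (fun i => by rintro x ⟨y, hy, rfl⟩; exact hy) = LinearMap.id :=
                grMap_id _
              rw [this]
              apply LinearMap.ext; intro x
              rfl }
  comp {M N O} φ ψ' :=
    { f := ψ'.f ∘ₗ φ.f
      hFil := fun i => by
        rintro x ⟨y, hy, rfl⟩
        exact ψ'.hFil i ⟨φ.f y, φ.hFil i ⟨y, hy, rfl⟩, rfl⟩
      compat := by
        have hcomp : grMap (ψ'.f ∘ₗ φ.f) (fun i => by
              rintro x ⟨y, hy, rfl⟩
              exact ψ'.hFil i ⟨φ.f y, φ.hFil i ⟨y, hy, rfl⟩, rfl⟩)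
            = (grMap ψ'.f ψ'.hFil) ∘ₗ (grMap φ.f φ.hFil) :=
          grMap_comp _ _ _ _ _
        rw [hcomp]
        have htw : (twMap k (σ := frobenius k p)
              ((grMap ψ'.f ψ'.hFil) ∘ₗ (grMap φ.f φ.hFil)))
            = (twMap k (grMap ψ'.f ψ'.hFil)) ∘ₗ (twMap k (grMap φ.f φ.hFil)) := rfl
        rw [htw, ← LinearMap.comp_assoc, ψ'.compat, LinearMap.comp_assoc, φ.compat,
          ← LinearMap.comp_assoc] }
  id_comp φ := by apply FLHom.ext; apply LinearMap.ext; intro x; rfl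
  comp_id φ := by apply FLHom.ext; apply LinearMap.ext; intro x; rfl
  assoc := by intros; apply FLHom.ext; apply LinearMap.ext; intro x; rfl

set_option linter.unusedSectionVars false

section GradedModule

variable {k}
variable {V₁ V₂ V₃ : Type u} [AddCommGroup V₁] [Module k V₁] [AddCommGroup V₂]
  [Module k V₂] [AddCommGroup V₃] [Module k V₃]
  {Fil₁ : ℤ → Submodule k V₁} {Fil₂ : ℤ → Submodule k V₂} {Fil₃ : ℤ → Submodule k V₃}

/-- The projection of `Fil^i` onto the `i`-th graded piece. -/
def grPieceMk (Fil : ℤ → Submodule k V₁) (i : ℤ) : Fil i →ₗ[k] GrPiece Fil i :=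
  Submodule.mkQ (Submodule.comap (Fil i).subtype (Fil (i + 1)))

theorem grPieceMk_surjective (i : ℤ) : Function.Surjective (grPieceMk Fil₁ i) :=
  Submodule.mkQ_surjective _

theorem grPieceMk_eq_zero {i : ℤ} {v : Fil₁ i} :
    grPieceMk Fil₁ i v = 0 ↔ (v : V₁) ∈ Fil₁ (i + 1) :=
  Submodule.Quotient.mk_eq_zero _

/-- The class of an element of `Fil^i` in the total graded module. -/
def grMk (Fil : ℤ → Submodule k V₁) (i : ℤ) : Fil i →ₗ[k] GrModule Fil :=
  (DFinsupp.lsingle i : GrPiece Fil i →ₗ[k] Π₀ i, GrPiece Fil i) ∘ₗ grPieceMk Fil i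

theorem grMk_congr {i : ℤ} {v w : Fil₁ i} (h : grPieceMk Fil₁ i v = grPieceMk Fil₁ i w) :
    grMk Fil₁ i v = grMk Fil₁ i w :=
  congrArg (DFinsupp.lsingle i : GrPiece Fil₁ i →ₗ[k] Π₀ i, GrPiece Fil₁ i) h

/-- The `i`-th component of an element of the total graded module. -/
def grProj (Fil : ℤ → Submodule k V₁) (i : ℤ) : GrModule Fil →ₗ[k] GrPiece Fil i :=
  (DFinsupp.lapply i : (Π₀ i, GrPiece Fil i) →ₗ[k] GrPiece Fil i)

theorem grProj_grMk_self (i : ℤ) (v : Fil₁ i) :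
    grProj Fil₁ i (grMk Fil₁ i v) = grPieceMk Fil₁ i v :=
  DFinsupp.single_eq_same

theorem grModule_ext {x y : GrModule Fil₁} (h : ∀ i, grProj Fil₁ i x = grProj Fil₁ i y) :
    x = y :=
  DFinsupp.ext h

theorem grProj_grMap (f : V₁ →ₗ[k] V₂) (hf : ∀ i, (Fil₁ i).map f ≤ Fil₂ i) (i : ℤ)
    (x : GrModule Fil₁) :
    grProj Fil₂ i (grMap f hf x) = grPieceMap f hf i (grProj Fil₁ i x) :=
  DFinsupp.mapRange_apply (fun i => grPieceMap f hf i) (fun _ => map_zero _) x i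

theorem grPieceMap_grPieceMk (f : V₁ →ₗ[k] V₂) (hf : ∀ i, (Fil₁ i).map f ≤ Fil₂ i) (i : ℤ)
    (v : Fil₁ i) :
    grPieceMap f hf i (grPieceMk Fil₁ i v) = grPieceMk Fil₂ i ⟨f v, hf i ⟨v, v.2, rfl⟩⟩ :=
  rfl

theorem grMap_grMk (f : V₁ →ₗ[k] V₂) (hf : ∀ i, (Fil₁ i).map f ≤ Fil₂ i) (i : ℤ) (v : Fil₁ i) :
    grMap f hf (grMk Fil₁ i v) = grMk Fil₂ i ⟨f v, hf i ⟨v, v.2, rfl⟩⟩ :=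
  (DFinsupp.mapRange_single (hf := fun i => map_zero (grPieceMap f hf i))).trans
    (congrArg _ (grPieceMap_grPieceMk f hf i v))

theorem mem_of_forall_grMk_mem (A : AddSubmonoid (GrModule Fil₁)) (x : GrModule Fil₁)
    (h : ∀ i (v : Fil₁ i), grPieceMk Fil₁ i v = grProj Fil₁ i x → grMk Fil₁ i v ∈ A) : x ∈ A := by
  classical
  have hx : x = DFinsupp.sum (β := GrPiece Fil₁) x
      (DFinsupp.single : ∀ i, GrPiece Fil₁ i → Π₀ i, GrPiece Fil₁ i) :=
    (DFinsupp.sum_single (β := GrPiece Fil₁)).symm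
  rw [hx]
  refine dfinsuppSum_mem (γ := GrModule Fil₁) A _ _ fun i _ => ?_
  obtain ⟨v, hv⟩ := grPieceMk_surjective i (grProj Fil₁ i x)
  exact Eq.subst (motive := fun y => (show GrModule Fil₁ from DFinsupp.single i y) ∈ A) hv
    (h i v hv)

theorem grModule_addHom_ext {A : Type*} [AddZeroClass A] {f g : GrModule Fil₁ →+ A}
    (h : ∀ i v, f (grMk Fil₁ i v) = g (grMk Fil₁ i v)) : f = g := by
  ext x
  exact mem_of_forall_grMk_mem (AddMonoidHom.eqLocusM f g) x fun i v _ => h i v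

theorem grMap_eq_zero {f : V₁ →ₗ[k] V₂} {hf : ∀ i, (Fil₁ i).map f ≤ Fil₂ i} {x : GrModule Fil₁}
    (hx : grMap f hf x = 0) {i : ℤ} {v : Fil₁ i} (hv : grPieceMk Fil₁ i v = grProj Fil₁ i x) :
    f v ∈ Fil₂ (i + 1) := by
  have h := congrArg (grProj Fil₂ i) hx
  rw [grProj_grMap, ← hv, grPieceMap_grPieceMk, map_zero, grPieceMk_eq_zero] at h
  exact h

theorem grModule_eq_zero {x : GrModule Fil₁}
    (h : ∀ i (v : Fil₁ i), grPieceMk Fil₁ i v = grProj Fil₁ i x → (v : V₁) ∈ Fil₁ (i + 1)) :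
    x = 0 := by
  refine grModule_ext fun i => ?_
  obtain ⟨v, hv⟩ := grPieceMk_surjective i (grProj Fil₁ i x)
  rw [map_zero, ← hv, grPieceMk_eq_zero]
  exact h i v hv

theorem grMap_grMap_eq_zero {f : V₁ →ₗ[k] V₂} (hf : ∀ i, (Fil₁ i).map f ≤ Fil₂ i)
    {g : V₂ →ₗ[k] V₃} (hg : ∀ i, (Fil₂ i).map g ≤ Fil₃ i) (h : ∀ v, g (f v) = 0)
    (x : GrModule Fil₁) : grMap g hg (grMap f hf x) = 0 := by
  refine grModule_ext fun i => ?_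
  obtain ⟨v, hv⟩ := grPieceMk_surjective i (grProj Fil₁ i x)
  rw [grProj_grMap, grProj_grMap, ← hv, grPieceMap_grPieceMk, grPieceMap_grPieceMk, map_zero,
    grPieceMk_eq_zero]
  change g (f v) ∈ Fil₃ (i + 1)
  rw [h]
  exact zero_mem _

theorem grMap_injective {f : V₁ →ₗ[k] V₂} {hf : ∀ i, (Fil₁ i).map f ≤ Fil₂ i}
    (h : ∀ i v, f v ∈ Fil₂ i → v ∈ Fil₁ i) : Function.Injective (grMap f hf) :=
  (injective_iff_map_eq_zero _).2 fun _ hx =>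
    grModule_eq_zero fun i _ hv => h (i + 1) _ (grMap_eq_zero hx hv)

theorem grMap_surjective {f : V₁ →ₗ[k] V₂} {hf : ∀ i, (Fil₁ i).map f ≤ Fil₂ i}
    (h : ∀ i, Fil₂ i ≤ (Fil₁ i).map f) : Function.Surjective (grMap f hf) := fun x => by
  refine mem_of_forall_grMk_mem (AddMonoidHom.mrange (grMap f hf)) x fun i v _ => ?_
  obtain ⟨w, hw, hwv⟩ := h i v.2
  exact ⟨grMk Fil₁ i ⟨w, hw⟩, (grMap_grMk f hf i _).trans (congrArg _ (Subtype.ext hwv))⟩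

/-- A finite decreasing filtration of a vector space. -/
structure IsFiniteFiltration (Fil : ℤ → Submodule k V₁) : Prop where
  antitone : ∀ i j : ℤ, i ≤ j → Fil j ≤ Fil i
  exhaustive : ∃ a : ℤ, Fil a = ⊤
  separated : ∃ b : ℤ, Fil b = ⊥

namespace IsFiniteFiltration

theorem comap (h : IsFiniteFiltration Fil₂) {f : V₁ →ₗ[k] V₂} (hf : Function.Injective f) :
    IsFiniteFiltration fun i => (Fil₂ i).comap f where
  antitone i j hij := Submodule.comap_mono (h.antitone i j hij)
  exhaustive := h.exhaustive.imp fun a ha => by simp [ha]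
  separated := h.separated.imp fun b hb => by
    simpa [hb] using LinearMap.ker_eq_bot.2 hf

theorem map (h : IsFiniteFiltration Fil₁) {f : V₁ →ₗ[k] V₂} (hf : Function.Surjective f) :
    IsFiniteFiltration fun i => (Fil₁ i).map f where
  antitone i j hij := Submodule.map_mono (h.antitone i j hij)
  exhaustive := h.exhaustive.imp fun a ha => by
    simpa [ha] using LinearMap.range_eq_top.2 hf
  separated := h.separated.imp fun b hb => by simp [hb]

theorem prod (h₁ : IsFiniteFiltration Fil₁) (h₂ : IsFiniteFiltration Fil₂) :
    IsFiniteFiltration fun i => (Fil₁ i).prod (Fil₂ i) where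
  antitone i j hij := Submodule.prod_mono (h₁.antitone i j hij) (h₂.antitone i j hij)
  exhaustive := by
    obtain ⟨a, ha⟩ := h₁.exhaustive
    obtain ⟨b, hb⟩ := h₂.exhaustive
    refine ⟨min a b, ?_⟩
    have ha' := top_le_iff.1 (ha ▸ h₁.antitone _ _ (min_le_left a b))
    have hb' := top_le_iff.1 (hb ▸ h₂.antitone _ _ (min_le_right a b))
    rw [ha', hb', Submodule.prod_top]
  separated := by
    obtain ⟨a, ha⟩ := h₁.separated
    obtain ⟨b, hb⟩ := h₂.separated
    refine ⟨max a b, ?_⟩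
    have ha' := le_bot_iff.1 (ha ▸ h₁.antitone _ _ (le_max_left a b))
    have hb' := le_bot_iff.1 (hb ▸ h₂.antitone _ _ (le_max_right a b))
    rw [ha', hb', Submodule.prod_bot]

/-- Descending induction along a finite filtration. -/
theorem le_of_le_sup (h : IsFiniteFiltration Fil₁) {W : ℤ → Submodule k V₁}
    (hW : ∀ i, W (i + 1) ≤ W i) (hFil : ∀ i, Fil₁ i ≤ W i ⊔ Fil₁ (i + 1)) (i : ℤ) :
    Fil₁ i ≤ W i := by
  obtain ⟨b, hb⟩ := h.separated
  have key : ∀ n : ℕ, ∀ i, b ≤ i + n → Fil₁ i ≤ W i := by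
    intro n
    induction n with
    | zero =>
      intro i hi
      exact (h.antitone b i (by simpa using hi)).trans (hb ▸ bot_le)
    | succ n ih =>
      intro i hi
      exact (hFil i).trans (sup_le le_rfl ((ih (i + 1) (by push_cast at hi; linarith)).trans (hW i)))
  exact key (b - i).toNat i (by have := Int.self_le_toNat (b - i); linarith)

/-- A finite filtration of a vector space splits. -/
theorem exists_linearEquiv (h : IsFiniteFiltration Fil₁) : Nonempty (GrModule Fil₁ ≃ₗ[k] V₁) := by
  classical
  have hsec (i : ℤ) : ∃ s : GrPiece Fil₁ i →ₗ[k] Fil₁ i, grPieceMk Fil₁ i ∘ₗ s = LinearMap.id :=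
    (grPieceMk Fil₁ i).exists_rightInverse_of_surjective
      (LinearMap.range_eq_top.2 (grPieceMk_surjective i))
  choose s hs using hsec
  have hs' (i x) : grPieceMk Fil₁ i (s i x) = x := LinearMap.congr_fun (hs i) x
  let S' : (Π₀ i, GrPiece Fil₁ i) →ₗ[k] V₁ := DFinsupp.lsum ℕ fun i => (Fil₁ i).subtype ∘ₗ s i
  let S : GrModule Fil₁ →ₗ[k] V₁ := S'
  have hsingle (i x) : S' (DFinsupp.single i x) = s i x := by
    simp [S']
  refine ⟨LinearEquiv.ofBijective S ⟨?_, ?_⟩⟩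
  · refine (injective_iff_map_eq_zero _).2 fun x hx => ?_
    change Π₀ i, GrPiece Fil₁ i at x
    change S' x = 0 at hx
    change x = 0
    have hsum : ∑ i ∈ DFinsupp.support x, (s i (x i) : V₁) = 0 := by
      rw [← hx]
      conv_rhs => rw [← DFinsupp.sum_single (f := x)]
      rw [DFinsupp.sum, map_sum]
      exact Finset.sum_congr rfl fun i _ => (hsingle i _).symm
    by_contra hne
    have hsupp : (DFinsupp.support x).Nonempty :=
      Finset.nonempty_iff_ne_empty.2 fun h0 => hne (DFinsupp.support_eq_empty.1 h0)
    let i := (DFinsupp.support x).min' hsupp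
    have hi : i ∈ DFinsupp.support x := Finset.min'_mem _ _
    refine DFinsupp.mem_support_iff.1 hi ?_
    rw [← hs' i (x i), grPieceMk_eq_zero]
    rw [← Finset.add_sum_erase _ _ hi, add_eq_zero_iff_eq_neg] at hsum
    rw [hsum]
    refine neg_mem (sum_mem fun j hj => h.antitone (i + 1) j ?_ (s j (x j)).2)
    exact Int.add_one_le_of_lt
      ((Finset.min'_le _ j (Finset.mem_of_mem_erase hj)).lt_of_ne (Finset.ne_of_mem_erase hj).symm)
  · have hle := h.le_of_le_sup (W := fun _ => LinearMap.range S) (fun _ => le_rfl) fun i v hv => by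
      refine Submodule.mem_sup.2 ⟨S' (DFinsupp.single i (grPieceMk Fil₁ i ⟨v, hv⟩)), ⟨_, rfl⟩,
        v - s i (grPieceMk Fil₁ i ⟨v, hv⟩), ?_, ?_⟩
      · refine grPieceMk_eq_zero (v := ⟨v, hv⟩ - s i (grPieceMk Fil₁ i ⟨v, hv⟩)) |>.1 ?_
        rw [map_sub, hs', sub_self]
      · rw [hsingle, add_sub_cancel]
    obtain ⟨a, ha⟩ := h.exhaustive
    exact LinearMap.range_eq_top.1 (top_le_iff.1 (ha ▸ hle a))

end IsFiniteFiltration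

end GradedModule

section FontaineLaffaille

variable {p k}
variable {V₁ : Type u} [AddCommGroup V₁] [Module k V₁] {Fil₁ : ℤ → Submodule k V₁}

theorem rank_tw {σ : k →+* k} (hσ : Function.Bijective σ) :
    Module.rank k (Tw k σ V₁) = Module.rank k V₁ :=
  rank_eq_of_equiv_equiv (M := Tw k σ V₁) (M₁ := V₁) σ (AddEquiv.refl V₁) hσ fun _ _ => rfl

theorem rank_tw_grModule (h : IsFiniteFiltration Fil₁) :
    Module.rank k (Tw k (frobenius k p) (GrModule Fil₁)) = Module.rank k V₁ := by
  have := PerfectField.toPerfectRing (K := k) p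
  obtain ⟨e⟩ := h.exists_linearEquiv
  rw [rank_tw (bijective_frobenius k p), e.rank_eq]

theorem finrank_tw_grModule (h : IsFiniteFiltration Fil₁) :
    Module.finrank k (Tw k (frobenius k p) (GrModule Fil₁)) = Module.finrank k V₁ :=
  congrArg Cardinal.toNat (rank_tw_grModule h)

theorem finiteDimensional_tw_grModule [FiniteDimensional k V₁] (h : IsFiniteFiltration Fil₁) :
    FiniteDimensional k (Tw k (frobenius k p) (GrModule Fil₁)) := by
  rw [FiniteDimensional, ← Module.rank_lt_aleph0_iff, rank_tw_grModule h]
  exact Module.rank_lt_aleph0 k V₁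

theorem tw_grModule_injective_iff_surjective [FiniteDimensional k V₁] (h : IsFiniteFiltration Fil₁)
    {Ψ : Tw k (frobenius k p) (GrModule Fil₁) →ₗ[k] V₁} :
    Function.Injective Ψ ↔ Function.Surjective Ψ :=
  have := finiteDimensional_tw_grModule (p := p) h
  LinearMap.injective_iff_surjective_of_finrank_eq_finrank (finrank_tw_grModule h)

namespace FLMod

instance (M : FLMod p k) : FiniteDimensional k M.V := M.findim

theorem isFiniteFiltration (M : FLMod p k) : IsFiniteFiltration M.Fil :=
  ⟨M.antitone, M.exhaustive, M.separated⟩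

/-- The isomorphism `ψ`, as an additive map on the untwisted graded module. -/
def phi (M : FLMod p k) : GrModule M.Fil →+ M.V := M.ψ.toLinearMap.toAddMonoidHom

theorem phi_injective (M : FLMod p k) : Function.Injective M.phi := M.ψ.injective

/-- The Fontaine–Laffaille module attached to a filtered vector space and a bijective linear map
from the twist of the graded module. -/
noncomputable def ofBijective [FiniteDimensional k V₁] (h : IsFiniteFiltration Fil₁)
    (Ψ : Tw k (frobenius k p) (GrModule Fil₁) →ₗ[k] V₁) (hΨ : Function.Bijective Ψ) :
    FLMod p k where
  V := V₁
  findim := inferInstance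
  Fil := Fil₁
  antitone := h.antitone
  exhaustive := h.exhaustive
  separated := h.separated
  ψ := LinearEquiv.ofBijective Ψ hΨ

end FLMod

namespace FLHom

variable {M N Q : FLMod p k}

theorem hom_ext {φ χ : M ⟶ N} (h : ∀ x, φ.f x = χ.f x) : φ = χ :=
  FLHom.ext (LinearMap.ext h)

theorem congr_f {φ χ : M ⟶ N} (h : φ = χ) (x : M.V) : φ.f x = χ.f x := by rw [h]

theorem phi_grMap (φ : M ⟶ N) (x : GrModule M.Fil) :
    N.phi (grMap φ.f φ.hFil x) = φ.f (M.phi x) :=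
  LinearMap.congr_fun φ.compat x

theorem phi_grMk (φ : M ⟶ N) {i : ℤ} {v : M.V} (hv : v ∈ M.Fil i) {w : N.V} (hw : w ∈ N.Fil i)
    (h : φ.f v = w) : N.phi (grMk N.Fil i ⟨w, hw⟩) = φ.f (M.phi (grMk M.Fil i ⟨v, hv⟩)) := by
  subst h
  rw [← phi_grMap, grMap_grMk]

/-- The compatibility of a filtered map with `ψ` can be checked on homogeneous elements. -/
def ofGrMk (f : M.V →ₗ[k] N.V) (hf : ∀ i, (M.Fil i).map f ≤ N.Fil i)
    (h : ∀ i v (hv : v ∈ M.Fil i) (hfv : f v ∈ N.Fil i),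
      N.phi (grMk N.Fil i ⟨f v, hfv⟩) = f (M.phi (grMk M.Fil i ⟨v, hv⟩))) : M ⟶ N where
  f := f
  hFil := hf
  compat := by
    have : N.phi.comp (grMap f hf).toAddMonoidHom = f.toAddMonoidHom.comp M.phi :=
      grModule_addHom_ext fun i v => (congrArg N.phi (grMap_grMk f hf i v)).trans (h i v v.2 _)
    exact LinearMap.ext fun x => DFunLike.congr_fun this x

instance : Zero (M ⟶ N) where
  zero := ofGrMk 0 (fun i => by rintro _ ⟨_, _, rfl⟩; exact zero_mem _) fun i v _ _ =>
    (congrArg N.phi (map_zero (grMk N.Fil i))).trans (map_zero _)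

instance : Add (M ⟶ N) where
  add φ χ := ofGrMk (φ.f + χ.f)
    (fun i => by
      rintro _ ⟨v, hv, rfl⟩
      exact add_mem (φ.hFil i ⟨v, hv, rfl⟩) (χ.hFil i ⟨v, hv, rfl⟩))
    fun i v hv _ => by
      rw [LinearMap.add_apply φ.f χ.f (M.phi _), ← phi_grMk φ hv (φ.hFil i ⟨v, hv, rfl⟩) rfl,
        ← phi_grMk χ hv (χ.hFil i ⟨v, hv, rfl⟩) rfl, ← map_add, ← map_add]
      rfl

instance : Neg (M ⟶ N) where
  neg φ := ofGrMk (-φ.f)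
    (fun i => by
      rintro _ ⟨v, hv, rfl⟩
      exact neg_mem (φ.hFil i ⟨v, hv, rfl⟩))
    fun i v hv _ => by
      rw [LinearMap.neg_apply φ.f (M.phi _), ← phi_grMk φ hv (φ.hFil i ⟨v, hv, rfl⟩) rfl,
        ← map_neg, ← map_neg]
      rfl

instance : AddCommGroup (M ⟶ N) where
  add_assoc φ χ ω := hom_ext fun x => add_assoc (φ.f x) (χ.f x) (ω.f x)
  zero_add φ := hom_ext fun x => zero_add (φ.f x)
  add_zero φ := hom_ext fun x => add_zero (φ.f x)
  neg_add_cancel φ := hom_ext fun x => neg_add_cancel (φ.f x)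
  add_comm φ χ := hom_ext fun x => add_comm (φ.f x) (χ.f x)
  nsmul := nsmulRec
  zsmul := zsmulRec

instance : Preadditive (FLMod p k) where
  add_comp _ _ _ φ χ ω := hom_ext fun x => map_add ω.f (φ.f x) (χ.f x)
  comp_add _ _ _ _ _ _ := rfl

theorem comp_eq_zero_iff {φ : M ⟶ N} {χ : N ⟶ Q} :
    φ ≫ χ = 0 ↔ LinearMap.range φ.f ≤ LinearMap.ker χ.f := by
  refine ⟨?_, fun h => hom_ext fun x => h ⟨x, rfl⟩⟩
  rintro h _ ⟨x, rfl⟩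
  exact congr_f h x

/-- Morphisms of Fontaine–Laffaille modules are strict. -/
theorem map_fil (φ : M ⟶ N) (i : ℤ) :
    (M.Fil i).map φ.f = LinearMap.range φ.f ⊓ N.Fil i := by
  refine le_antisymm (le_inf LinearMap.map_le_range (φ.hFil i)) ?_
  let ι := (LinearMap.range φ.f).subtype
  let Fil' (i : ℤ) := (N.Fil i).comap ι
  have hFil' : IsFiniteFiltration Fil' := N.isFiniteFiltration.comap Subtype.val_injective
  let h := φ.f.rangeRestrict
  have hh (i) : (M.Fil i).map h ≤ Fil' i := by
    rintro _ ⟨v, hv, rfl⟩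
    exact φ.hFil i ⟨v, hv, rfl⟩
  have hι (i) : (Fil' i).map ι ≤ N.Fil i := Submodule.map_comap_le _ _
  have hιinj : Function.Injective (grMap ι hι) := grMap_injective fun _ _ hv => hv
  have hfac : grMap φ.f φ.hFil = grMap ι hι ∘ₗ grMap h hh := grMap_comp h hh ι hι φ.hFil
  let H : Tw k (frobenius k p) (GrModule M.Fil) →ₗ[k] Tw k (frobenius k p) (GrModule Fil') :=
    twMap k (grMap h hh)
  let J : Tw k (frobenius k p) (GrModule Fil') →ₗ[k] N.V :=
    N.ψ.toLinearMap ∘ₗ twMap k (grMap ι hι)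
  have hJ : Function.Injective J := N.ψ.injective.comp hιinj
  have hJH : J ∘ₗ H = φ.f ∘ₗ M.ψ.toLinearMap := by
    rw [← φ.compat]
    exact LinearMap.ext fun x => congrArg N.ψ (LinearMap.congr_fun hfac x).symm
  have hrange : (LinearMap.range H).map J = LinearMap.range φ.f := by
    rw [← LinearMap.range_comp, hJH, LinearMap.range_comp, LinearEquiv.range, Submodule.map_top]
  have := finiteDimensional_tw_grModule (p := p) hFil'
  have hH : Function.Surjective H := by
    refine LinearMap.range_eq_top.1 (Submodule.eq_top_of_finrank_eq ?_)
    rw [finrank_tw_grModule hFil', (Submodule.equivMapOfInjective J hJ _).finrank_eq]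
    exact congrArg (fun W : Submodule k N.V => Module.finrank k W) hrange
  have hle := hFil'.le_of_le_sup (W := fun i => (M.Fil i).map h)
    (fun i => Submodule.map_mono (M.antitone _ _ (by lia))) fun i v hv => by
      obtain ⟨(x : GrModule M.Fil), hx⟩ := hH (grMk Fil' i ⟨v, hv⟩)
      obtain ⟨w, hw⟩ := grPieceMk_surjective i (grProj M.Fil i x)
      refine Submodule.mem_sup.2 ⟨h w, ⟨w, w.2, rfl⟩, v - h w, ?_, add_sub_cancel _ _⟩
      refine (grPieceMk_eq_zero (v := (⟨v, hv⟩ - ⟨h w, hh i ⟨w, w.2, rfl⟩⟩ : Fil' i))).1 ?_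
      rw [map_sub, sub_eq_zero, ← grPieceMap_grPieceMk h hh, hw, ← grProj_grMap,
        ← grProj_grMk_self]
      exact congrArg (grProj Fil' i) hx.symm
  rintro _ ⟨⟨x, rfl⟩, hx⟩
  obtain ⟨w, hw, hwx⟩ := hle i (show h x ∈ Fil' i from hx)
  exact ⟨w, hw, congrArg Subtype.val hwx⟩

/-- A morphism whose image lies in that of an injective morphism factors through it. -/
theorem exists_lift (ι : M ⟶ N) (hι : Function.Injective ι.f) (g : Q ⟶ N)
    (h : LinearMap.range g.f ≤ LinearMap.range ι.f) : ∃ l : Q ⟶ M, l ≫ ι = g := by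
  let l : Q.V →ₗ[k] M.V := (LinearEquiv.ofInjective ι.f hι).symm.toLinearMap ∘ₗ
    g.f.codRestrict (LinearMap.range ι.f) fun x => h ⟨x, rfl⟩
  have hl (x) : ι.f (l x) = g.f x :=
    congrArg Subtype.val ((LinearEquiv.ofInjective ι.f hι).apply_symm_apply _)
  refine ⟨ofGrMk l ?_ fun i v hv hlv => hι ?_, hom_ext hl⟩
  · rintro i _ ⟨v, hv, rfl⟩
    obtain ⟨w, hw, hwv⟩ : g.f v ∈ (M.Fil i).map ι.f :=
      map_fil ι i ▸ ⟨h ⟨v, rfl⟩, g.hFil i ⟨v, hv, rfl⟩⟩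
    rwa [← hι (hwv.trans (hl v).symm)]
  · rw [hl, ← phi_grMk g hv (g.hFil i ⟨v, hv, rfl⟩) rfl, ← phi_grMk ι hlv _ (hl v)]

/-- A morphism that vanishes on the kernel of a surjective morphism factors through it. -/
theorem exists_desc (π : M ⟶ N) (hπ : Function.Surjective π.f) (g : M ⟶ Q)
    (h : LinearMap.ker π.f ≤ LinearMap.ker g.f) : ∃ l : N ⟶ Q, π ≫ l = g := by
  let l : N.V →ₗ[k] Q.V :=
    (LinearMap.ker π.f).liftQ g.f h ∘ₗ (π.f.quotKerEquivOfSurjective hπ).symm.toLinearMap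
  have hl (x) : l (π.f x) = g.f x := by
    have : (π.f.quotKerEquivOfSurjective hπ).symm (π.f x) = (LinearMap.ker π.f).mkQ x :=
      (LinearEquiv.symm_apply_eq _).2 rfl
    simp only [l, LinearMap.comp_apply, LinearEquiv.coe_coe, this]
    rfl
  have hfil (i : ℤ) : ∀ v ∈ N.Fil i, ∃ w ∈ M.Fil i, π.f w = v := fun v hv =>
    (map_fil π i).ge ⟨hπ v, hv⟩
  refine ⟨ofGrMk l ?_ ?_, hom_ext hl⟩
  · rintro i _ ⟨v, hv, rfl⟩
    obtain ⟨w, hw, rfl⟩ := hfil i v hv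
    rw [hl]
    exact g.hFil i ⟨w, hw, rfl⟩
  · intro i v hv hlv
    obtain ⟨w, hw, rfl⟩ := hfil i v hv
    rw [phi_grMk π hw hv rfl, hl (M.phi _), ← phi_grMk g hw hlv (hl w).symm]

theorem exists_kernel (φ : M ⟶ N) : ∃ (K : FLMod p k) (ι : K ⟶ M),
    Function.Injective ι.f ∧ LinearMap.range ι.f = LinearMap.ker φ.f := by
  let ι := (LinearMap.ker φ.f).subtype
  let Fil' (i : ℤ) := (M.Fil i).comap ι
  have hFil' : IsFiniteFiltration Fil' := M.isFiniteFiltration.comap Subtype.val_injective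
  have hι (i) : (Fil' i).map ι ≤ M.Fil i := Submodule.map_comap_le _ _
  have hmem (x : Tw k (frobenius k p) (GrModule Fil')) :
      M.ψ (twMap k (grMap ι hι) x) ∈ LinearMap.ker φ.f := by
    have h0 : grMap φ.f φ.hFil (grMap ι hι x) = 0 :=
      grMap_grMap_eq_zero hι φ.hFil (fun v => v.2) x
    exact (phi_grMap φ _).symm.trans ((congrArg N.phi h0).trans (map_zero _))
  let Ψ := (M.ψ.toLinearMap ∘ₗ twMap k (grMap ι hι)).codRestrict (LinearMap.ker φ.f) hmem
  have hΨ : Function.Injective Ψ := fun x y hxy =>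
    grMap_injective (f := ι) (hf := hι) (fun _ _ hv => hv)
      (M.ψ.injective (congrArg Subtype.val hxy))
  refine ⟨.ofBijective hFil' Ψ ⟨hΨ, (tw_grModule_injective_iff_surjective hFil').1 hΨ⟩,
    ⟨ι, hι, rfl⟩, Subtype.val_injective, Submodule.range_subtype _⟩

theorem exists_cokernel (φ : M ⟶ N) : ∃ (Q : FLMod p k) (π : N ⟶ Q),
    Function.Surjective π.f ∧ LinearMap.ker π.f = LinearMap.range φ.f := by
  let π := (LinearMap.range φ.f).mkQ
  have hπ : Function.Surjective π := Submodule.mkQ_surjective _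
  let Fil' (i : ℤ) := (N.Fil i).map π
  have hFil' : IsFiniteFiltration Fil' := N.isFiniteFiltration.map hπ
  let P : Tw k (frobenius k p) (GrModule N.Fil) →ₗ[k] Tw k (frobenius k p) (GrModule Fil') :=
    twMap k (grMap π fun _ => le_rfl)
  have hP : Function.Surjective P :=
    grMap_surjective (f := π) (hf := fun _ => le_rfl) fun _ => le_rfl
  have hker : LinearMap.ker P ≤ LinearMap.ker (π ∘ₗ N.ψ.toLinearMap) := fun x hx => by
    refine (Submodule.Quotient.mk_eq_zero _).2 ?_
    refine mem_of_forall_grMk_mem ((LinearMap.range φ.f).toAddSubmonoid.comap N.phi) x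
      fun i v hv => ?_
    obtain ⟨w, hw, hwv⟩ : π v ∈ Fil' (i + 1) := grMap_eq_zero (f := π) hx hv
    have hvw : (v : N.V) - w ∈ LinearMap.range φ.f :=
      (Submodule.Quotient.eq _).1 hwv.symm
    obtain ⟨u, hu, huv⟩ := (map_fil φ i).ge
      ⟨hvw, sub_mem v.2 (N.antitone _ _ (by lia) hw)⟩
    have hvw' : grPieceMk N.Fil i v = grPieceMk N.Fil i ⟨φ.f u, φ.hFil i ⟨u, hu, rfl⟩⟩ := by
      rw [← sub_eq_zero, ← map_sub, grPieceMk_eq_zero]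
      simpa [huv] using hw
    exact ⟨M.phi (grMk M.Fil i ⟨u, hu⟩), by
      rw [← phi_grMk φ hu (φ.hFil i ⟨u, hu, rfl⟩) rfl, grMk_congr hvw']⟩
  let Ψ := (LinearMap.ker P).liftQ _ hker ∘ₗ (P.quotKerEquivOfSurjective hP).symm.toLinearMap
  have hΨP (x) : Ψ (P x) = π (N.ψ x) := by
    have : (P.quotKerEquivOfSurjective hP).symm (P x) = (LinearMap.ker P).mkQ x :=
      (LinearEquiv.symm_apply_eq _).2 rfl
    simp only [Ψ, LinearMap.comp_apply, LinearEquiv.coe_coe, this]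
    rfl
  have hΨ : Function.Surjective Ψ := fun x => by
    obtain ⟨y, rfl⟩ := hπ x
    exact ⟨P (N.ψ.symm y), by rw [hΨP, N.ψ.apply_symm_apply]⟩
  exact ⟨.ofBijective hFil' Ψ ⟨(tw_grModule_injective_iff_surjective hFil').2 hΨ, hΨ⟩,
    ⟨π, fun _ => le_rfl, LinearMap.ext hΨP⟩, hπ, Submodule.ker_mkQ _⟩

open Limits

theorem isLimit_of_range_eq_ker {φ : N ⟶ Q} {ι : M ⟶ N} (hι : Function.Injective ι.f)
    (h : LinearMap.range ι.f = LinearMap.ker φ.f) (w : ι ≫ φ = 0) :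
    Nonempty (IsLimit (KernelFork.ofι ι w)) := by
  choose l hl using fun (A : FLMod p k) (g : A ⟶ N) (hg : g ≫ φ = 0) =>
    exists_lift ι hι g ((comp_eq_zero_iff.1 hg).trans h.ge)
  exact ⟨KernelFork.IsLimit.ofι ι w (fun g hg => l _ g hg) (fun g hg => hl _ g hg)
    fun g hg m hm => hom_ext fun x => hι (congr_f (hm.trans (hl _ g hg).symm) x)⟩

theorem isColimit_of_ker_eq_range {φ : M ⟶ N} {π : N ⟶ Q} (hπ : Function.Surjective π.f)
    (h : LinearMap.ker π.f = LinearMap.range φ.f) (w : φ ≫ π = 0) :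
    Nonempty (IsColimit (CokernelCofork.ofπ π w)) := by
  choose l hl using fun (A : FLMod p k) (g : N ⟶ A) (hg : φ ≫ g = 0) =>
    exists_desc π hπ g (h.le.trans (comp_eq_zero_iff.1 hg))
  refine ⟨CokernelCofork.IsColimit.ofπ π w (fun g hg => l _ g hg) (fun g hg => hl _ g hg)
    fun g hg m hm => hom_ext fun x => ?_⟩
  obtain ⟨y, rfl⟩ := hπ x
  exact congr_f (hm.trans (hl _ g hg).symm) y

theorem injective_of_mono (φ : M ⟶ N) [Mono φ] : Function.Injective φ.f := by
  obtain ⟨K, ι, -, h⟩ := exists_kernel φ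
  have h0 : ι = 0 := (cancel_mono φ).1 ((comp_eq_zero_iff.2 h.le).trans zero_comp.symm)
  rw [← LinearMap.ker_eq_bot, ← h, h0]
  exact LinearMap.range_zero

theorem surjective_of_epi (φ : M ⟶ N) [Epi φ] : Function.Surjective φ.f := by
  obtain ⟨Q, π, -, h⟩ := exists_cokernel φ
  have h0 : π = 0 := (cancel_epi φ).1 ((comp_eq_zero_iff.2 h.ge).trans comp_zero.symm)
  rw [← LinearMap.range_eq_top, ← h, h0]
  exact LinearMap.ker_zero

end FLHom

namespace FLMod

open Limits FLHom

instance : HasKernels (FLMod p k) where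
  has_limit φ := by
    obtain ⟨K, ι, hι, h⟩ := exists_kernel φ
    obtain ⟨hlim⟩ := isLimit_of_range_eq_ker hι h (comp_eq_zero_iff.2 h.le)
    exact ⟨⟨_, hlim⟩⟩

instance : HasCokernels (FLMod p k) where
  has_colimit φ := by
    obtain ⟨Q, π, hπ, h⟩ := exists_cokernel φ
    obtain ⟨hcolim⟩ := isColimit_of_ker_eq_range hπ h (comp_eq_zero_iff.2 h.ge)
    exact ⟨⟨_, hcolim⟩⟩

instance : IsNormalMonoCategory (FLMod p k) where
  normalMonoOfMono φ _ := by
    obtain ⟨Q, π, -, h⟩ := exists_cokernel φ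
    have w : φ ≫ π = 0 := comp_eq_zero_iff.2 h.ge
    obtain ⟨hlim⟩ := isLimit_of_range_eq_ker (injective_of_mono φ) h.symm w
    exact ⟨⟨Q, π, w, hlim⟩⟩

instance : IsNormalEpiCategory (FLMod p k) where
  normalEpiOfEpi φ _ := by
    obtain ⟨K, ι, -, h⟩ := exists_kernel φ
    have w : ι ≫ φ = 0 := comp_eq_zero_iff.2 h.le
    obtain ⟨hcolim⟩ := isColimit_of_ker_eq_range (surjective_of_epi φ) h.symm w
    exact ⟨⟨K, ι, w, hcolim⟩⟩

theorem exists_isZero : ∃ Z : FLMod.{u} p k, IsZero Z := by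
  let Fil (_ : ℤ) : Submodule k PUnit.{u + 1} := ⊥
  have hFil : IsFiniteFiltration Fil :=
    ⟨fun _ _ _ => le_rfl, ⟨0, Subsingleton.elim _ _⟩, ⟨0, rfl⟩⟩
  have hsurj : Function.Surjective
      (0 : Tw k (frobenius k p) (GrModule Fil) →ₗ[k] PUnit.{u + 1}) :=
    Function.surjective_to_subsingleton _
  let Z : FLMod p k := .ofBijective hFil 0
    ⟨(tw_grModule_injective_iff_surjective hFil).2 hsurj, hsurj⟩
  refine ⟨Z, (IsZero.iff_id_eq_zero Z).2 (hom_ext fun x => ?_)⟩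
  exact Subsingleton.elim (α := PUnit) _ _

theorem hasBinaryBiproduct (M N : FLMod p k) : HasBinaryBiproduct M N := by
  let Fil (i : ℤ) := (M.Fil i).prod (N.Fil i)
  have hFil : IsFiniteFiltration Fil := M.isFiniteFiltration.prod N.isFiniteFiltration
  have hfst (i) : (Fil i).map (LinearMap.fst k M.V N.V) ≤ M.Fil i := by
    rintro _ ⟨v, hv, rfl⟩
    exact hv.1
  have hsnd (i) : (Fil i).map (LinearMap.snd k M.V N.V) ≤ N.Fil i := by
    rintro _ ⟨v, hv, rfl⟩
    exact hv.2
  have hinl (i) : (M.Fil i).map (LinearMap.inl k M.V N.V) ≤ Fil i := by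
    rintro _ ⟨v, hv, rfl⟩
    exact ⟨hv, zero_mem _⟩
  have hinr (i) : (N.Fil i).map (LinearMap.inr k M.V N.V) ≤ Fil i := by
    rintro _ ⟨v, hv, rfl⟩
    exact ⟨zero_mem _, hv⟩
  let Ψ : Tw k (frobenius k p) (GrModule Fil) →ₗ[k] M.V × N.V :=
    (M.ψ.toLinearMap ∘ₗ twMap k (grMap _ hfst)).prod (N.ψ.toLinearMap ∘ₗ twMap k (grMap _ hsnd))
  have hΨ : Function.Injective Ψ := by
    refine (injective_iff_map_eq_zero _).2 fun x hx => ?_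
    have h₁ : grMap _ hfst x = 0 :=
      M.phi_injective ((congrArg Prod.fst hx).trans (map_zero M.phi).symm)
    have h₂ : grMap _ hsnd x = 0 :=
      N.phi_injective ((congrArg Prod.snd hx).trans (map_zero N.phi).symm)
    exact grModule_eq_zero fun i v hv => ⟨grMap_eq_zero h₁ hv, grMap_eq_zero h₂ hv⟩
  let P : FLMod p k :=
    .ofBijective hFil Ψ ⟨hΨ, (tw_grModule_injective_iff_surjective hFil).1 hΨ⟩
  let inl : M ⟶ P := ofGrMk (LinearMap.inl k M.V N.V) hinl fun i v hv hlv =>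
    Prod.ext (congrArg M.phi (grMap_grMk _ hfst i ⟨(v, 0), hlv⟩))
      ((congrArg N.phi ((grMap_grMk _ hsnd i ⟨(v, 0), hlv⟩).trans
        (map_zero (grMk N.Fil i)))).trans (map_zero _))
  let inr : N ⟶ P := ofGrMk (LinearMap.inr k M.V N.V) hinr fun i v hv hlv =>
    Prod.ext ((congrArg M.phi ((grMap_grMk _ hfst i ⟨(0, v), hlv⟩).trans
      (map_zero (grMk M.Fil i)))).trans (map_zero _))
      (congrArg N.phi (grMap_grMk _ hsnd i ⟨(0, v), hlv⟩))
  let b : BinaryBicone M N :=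
    { pt := P
      fst := ⟨LinearMap.fst k M.V N.V, hfst, rfl⟩
      snd := ⟨LinearMap.snd k M.V N.V, hsnd, rfl⟩
      inl := inl
      inr := inr
      inl_fst := rfl
      inl_snd := rfl
      inr_fst := rfl
      inr_snd := rfl }
  exact hasBinaryBiproduct_of_total b (hom_ext fun x => Prod.ext (add_zero x.1) (zero_add x.2))

instance : HasFiniteProducts (FLMod p k) := by
  have : HasZeroObject (FLMod p k) := ⟨exists_isZero⟩
  have : HasBinaryBiproducts (FLMod p k) := ⟨hasBinaryBiproduct⟩
  exact hasFiniteProducts_of_has_binary_and_terminal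

instance : Abelian (FLMod p k) where

end FLMod

end FontaineLaffaille

/-- **`MF(k)` is an abelian category and its morphisms are strict.**  The
category of Fontaine–Laffaille modules over a perfect field `k` of
characteristic `p > 0` is abelian, and every morphism
`f : (V₁, Fil₁, ψ₁) → (V₂, Fil₂, ψ₂)` is strict with respect to the
filtrations: `f(Fil₁^i V₁) = f(V₁) ∩ Fil₂^i V₂` for all `i`. -/
theorem FLMod_abelian_and_strict :
    Nonempty (Abelian (FLMod p k)) ∧
      ∀ (M N : FLMod p k) (φ : M ⟶ N) (i : ℤ),
        (M.Fil i).map φ.f = LinearMap.range φ.f ⊓ N.Fil i := by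
  exact ⟨⟨inferInstance⟩, fun _ _ φ i => FLHom.map_fil φ i⟩
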